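/- Suppose the weight vector w satisfies r₁ ≤_w r₂ ≤_w ⋯ ≤_w r_k. For every n ∈ S with n > R², the element n − r_k belongs to S and the minimum weighted length function satisfies m_w(n) = m_w(n − r_k) + w_k. -/

import Mathlib

open Finset

/-- Among `m` consecutive terms of a sequence there is a nonempty block of consecutive terms whose
sum is divisible by `m`. -/
lemma exists_dvd_sum_Ico (g : ℕ → ℕ) {m : ℕ} (hm : 0 < m) :
    ∃ i j, i < j ∧ j ≤ m ∧ m ∣ ∑ t ∈ Ico i j, g t := by
  obtain ⟨x, hx, y, hy, hxy, h⟩ := exists_ne_map_eq_of_card_lt_of_maps_to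
    (s := range (m + 1)) (t := range m) (f := fun j => (∑ t ∈ range j, g t) % m) (by simp)
    (fun j _ => by simpa using Nat.mod_lt _ hm)
  wlog hlt : x < y generalizing x y
  · exact this y hy x hx hxy.symm h.symm (by omega)
  refine ⟨x, y, hlt, by simpa [Nat.lt_succ_iff] using hy, ?_⟩
  have hsum := sum_range_add_sum_Ico g hlt.le
  have hdvd := (Nat.modEq_iff_dvd' (by omega)).1 (show _ ≡ _ [MOD m] from h)
  rwa [← hsum, Nat.add_sub_cancel_left] at hdvd

/-- A multiplicity vector of total size at least `m` dominates a nonzero one whose `r`-weighted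
sum is divisible by `m`. -/
lemma exists_le_dvd_sum_mul {ι : Type*} [Fintype ι] (z r : ι → ℕ) {m : ℕ} (hm : 0 < m)
    (hz : m ≤ ∑ i, z i) :
    ∃ b : ι → ℕ, b ≤ z ∧ b ≠ 0 ∧ m ∣ ∑ i, b i * r i := by
  classical
  let e : (Σ i, Fin (z i)) ≃ Fin (∑ i, z i) := Fintype.equivFinOfCardEq (by simp)
  let a : ℕ → ι := fun t => (e.symm ⟨t % ∑ i, z i, Nat.mod_lt _ (hm.trans_le hz)⟩).1
  obtain ⟨x, y, hxy, hym, hdvd⟩ := exists_dvd_sum_Ico (fun t => r (a t)) hm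
  refine ⟨fun i => #{t ∈ Ico x y | a t = i}, fun i => ?_, fun h => ?_, ?_⟩
  · have hsub : {t ∈ Ico x y | a t = i} ⊆ univ.image fun c : Fin (z i) => (e ⟨i, c⟩ : ℕ) := by
      intro t ht
      simp only [mem_filter, mem_Ico] at ht
      obtain ⟨⟨-, hty⟩, rfl⟩ := ht
      refine mem_image.2 ⟨(e.symm ⟨t % ∑ i, z i, _⟩).2, mem_univ _, ?_⟩
      simpa [a] using Nat.mod_eq_of_lt (by omega)
    simpa using (card_le_card hsub).trans card_image_le
  · have hx := congrFun h (a x)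
    simp only [Pi.zero_apply, card_eq_zero] at hx
    exact notMem_empty x (hx ▸ by simp [hxy])
  · convert hdvd using 1
    rw [← sum_fiberwise (Ico x y) a]
    refine sum_congr rfl fun i _ => ?_
    rw [sum_congr rfl fun t ht => by rw [(mem_filter.1 ht).2], sum_const, smul_eq_mul]

/-- If `w l / r l` is minimal, a factorization with at least `r l` atoms can be exchanged for one
that uses the atom `r l` and has no larger weighted length. -/
lemma exists_factorization_pos {ι : Type*} [Fintype ι] {r : ι → ℕ} (hr : ∀ i, 0 < r i)
    {w : ι → ℚ} {l : ι} (hw : ∀ i, w l / r l ≤ w i / r i) {z : ι → ℕ}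
    (hz : r l ≤ ∑ i, z i) :
    ∃ y : ι → ℕ, ∑ i, y i * r i = ∑ i, z i * r i ∧
      ∑ i, (y i : ℚ) * w i ≤ ∑ i, (z i : ℚ) * w i ∧ 0 < y l := by
  classical
  obtain ⟨b, hbz, hb, c, hc⟩ := exists_le_dvd_sum_mul z r (hr l) hz
  have hcpos : 0 < c := by
    obtain ⟨i, hi⟩ := Function.ne_iff.1 hb
    refine Nat.pos_of_ne_zero fun h => ?_
    rw [h, mul_zero, sum_eq_zero_iff] at hc
    exact (Nat.mul_pos (Nat.pos_of_ne_zero hi) (hr i)).ne' (hc i (mem_univ i))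
  have hwc : (c : ℚ) * w l ≤ ∑ i, (b i : ℚ) * w i := by
    have hl : (0 : ℚ) < r l := mod_cast hr l
    calc (c : ℚ) * w l = (r l * c : ℕ) * (w l / r l) := by push_cast; field_simp
      _ = ∑ i, (b i * r i : ℚ) * (w l / r l) := by rw [← hc]; push_cast; rw [sum_mul]
      _ ≤ ∑ i, (b i : ℚ) * w i := sum_le_sum fun i _ => by
        have hi : (0 : ℚ) < r i := mod_cast hr i
        calc (b i * r i : ℚ) * (w l / r l) ≤ (b i * r i : ℚ) * (w i / r i) := by
              exact mul_le_mul_of_nonneg_left (hw i) (by positivity)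
          _ = b i * w i := by field_simp
  refine ⟨fun i => z i - b i + Pi.single (M := fun _ => ℕ) l c i, ?_, ?_, ?_⟩
  · have hsingle : ∑ i, Pi.single (M := fun _ => ℕ) l c i * r i = ∑ i, b i * r i := by
      simp [hc, Pi.single_apply, mul_comm c]
    simp only [add_mul, sum_add_distrib]
    rw [hsingle, ← sum_add_distrib]
    exact sum_congr rfl fun i _ => by rw [← add_mul, Nat.sub_add_cancel (hbz i)]
  · have hcast : ∀ i, ((z i - b i : ℕ) : ℚ) = z i - b i := fun i => Nat.cast_sub (hbz i)
    have hsingle : ∑ i, (Pi.single (M := fun _ => ℕ) l c i : ℚ) * w i = c * w l := by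
      simp [Pi.single_apply]
    simp only [Nat.cast_add, hcast, add_mul, sub_mul, sum_add_distrib, sum_sub_distrib]
    rw [hsingle]
    linarith
  · simp [hcpos]

/-- The factorizations of `n` with respect to positive generators form a finite set. -/
lemma finite_factorizations {ι : Type*} [Fintype ι] {r : ι → ℕ} (hr : ∀ i, 0 < r i) (n : ℕ) :
    {z : ι → ℕ | n = ∑ i, z i * r i}.Finite := by
  classical
  refine (Set.finite_Iic (fun _ : ι => n)).subset fun z hz i => ?_
  calc z i ≤ z i * r i := Nat.le_mul_of_pos_right _ (hr i)
    _ ≤ ∑ i, z i * r i := single_le_sum (f := fun i => z i * r i) (by simp) (mem_univ i)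
    _ = n := hz.symm


/-- Theorem (min weighted length is eventually quasilinear): for `n ∈ S` with `n > R²`
(where `R = max rᵢ`), we have `n - r_k ∈ S` and `m_w(n) = m_w(n - r_k) + w_k`.
Here `L N` is the weighted length set of `N`, and the minimum weighted length is
expressed via `IsLeast`. -/
theorem stmt_3 (k : ℕ) (hk : 1 ≤ k) (r : Fin (k+1) → ℕ) (hr : ∀ i, 0 < r i)
    (w : Fin (k+1) → ℚ)
    (hsort : ∀ i j : Fin (k+1), i ≤ j → w j / (r j : ℚ) ≤ w i / (r i : ℚ))
    (L : ℕ → Set ℚ)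
    (hL : ∀ N : ℕ, L N = {q | ∃ z : Fin (k+1) → ℕ,
      N = ∑ i, z i * r i ∧ q = ∑ i, (z i : ℚ) * w i})
    (n : ℕ) (hnS : ∃ z : Fin (k+1) → ℕ, n = ∑ i, z i * r i)
    (hn : (Finset.univ.sup r) ^ 2 < n) :
    (∃ z : Fin (k+1) → ℕ, n - r (Fin.last k) = ∑ i, z i * r i) ∧
    ∃ M M' : ℚ, IsLeast (L n) M ∧ IsLeast (L (n - r (Fin.last k))) M' ∧
      M = M' + w (Fin.last k) := by
  set l := Fin.last k
  have hcard : ∀ z : Fin (k + 1) → ℕ, n = ∑ i, z i * r i → r l ≤ ∑ i, z i := by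
    intro z hz
    have hle : n ≤ (∑ i, z i) * univ.sup r := by
      rw [hz, sum_mul]
      exact sum_le_sum fun i _ => Nat.mul_le_mul_left _ (le_sup (f := r) (mem_univ i))
    have hlt : univ.sup r < ∑ i, z i := by
      by_contra! h
      have := Nat.mul_le_mul_right (univ.sup r) h
      rw [sq] at hn
      omega
    exact (le_sup (f := r) (mem_univ l)).trans hlt.le
  obtain ⟨z, hz, hzmin⟩ := Set.exists_min_image _ (fun z : Fin (k + 1) → ℕ => ∑ i, (z i : ℚ) * w i)
    (finite_factorizations hr n) hnS
  obtain ⟨y, hyz, hyw, hypos⟩ := exists_factorization_pos hr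
    (fun i => hsort i l (Fin.le_last i)) (hcard z hz)
  obtain ⟨x, rfl⟩ : ∃ x : Fin (k + 1) → ℕ, y = x + Pi.single l 1 :=
    ⟨y - Pi.single l 1, (tsub_add_cancel_of_le fun i => by
      by_cases h : i = l
      · subst h; simpa using Nat.succ_le_of_lt hypos
      · simp [h]).symm⟩
  have hsum : ∀ x : Fin (k + 1) → ℕ,
      ∑ i, (x + Pi.single l 1 : Fin (k + 1) → ℕ) i * r i = ∑ i, x i * r i + r l := fun x => by
    simp [add_mul, sum_add_distrib, Pi.single_apply]
  have hweight : ∀ x : Fin (k + 1) → ℕ,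
      ∑ i, (((x + Pi.single l 1 : Fin (k + 1) → ℕ) i : ℕ) : ℚ) * w i = ∑ i, (x i : ℚ) * w i + w l := fun x => by
    simp [add_mul, sum_add_distrib, Pi.single_apply]
  have hx : n = ∑ i, x i * r i + r l := by rw [← hsum, hyz]; exact hz
  have hx' : n - r l = ∑ i, x i * r i := by omega
  rw [hweight] at hyw
  refine ⟨⟨x, hx'⟩, _, ∑ i, (x i : ℚ) * w i, ⟨?_, ?_⟩, ⟨?_, ?_⟩, rfl⟩
  · rw [hL]
    exact ⟨_, hx.trans (hsum x).symm, (hweight x).symm⟩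
  · rw [hL]
    rintro _ ⟨v, hv, rfl⟩
    exact hyw.trans (hzmin v hv)
  · rw [hL]
    exact ⟨x, hx', rfl⟩
  · rw [hL]
    rintro _ ⟨v, hv, rfl⟩
    have hmin := hzmin (v + Pi.single l 1) (by rw [Set.mem_ofPred_eq, hsum]; omega)
    rw [hweight] at hmin
    linarith
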